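/- arXiv:2512.12567 — 3 statements merged into one kernel-verified Lean document; each statement's English description precedes it below -/
import Mathlib

section
/- Let X be a set and M ∈ ℕ. For any hypothesis class H ⊆ {0,1}^X, if the minimal sequence length N(H,M) for forcing M mistakes is finite, then N(H,M) ≤ 2^M − 1. -/
/-- An adversary strategy: given the history of (prediction, label) pairs and the
learner's current prediction, output a label. -/
abbrev Adversary : Type := List (Bool × Bool) → Bool → Bool

/-- A learner strategy: given the past labels, output a prediction. -/
abbrev Learner : Type := List Bool → Bool

/-- The history of (prediction, label) pairs produced in the first `t` rounds of
playing learner `L` against adversary `A`. -/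
def hist (A : Adversary) (L : Learner) : ℕ → List (Bool × Bool)
  | 0 => []
  | t + 1 =>
      let h := hist A L t
      let p := L (h.map Prod.snd)
      h ++ [(p, A h p)]

/-- The learner's prediction at round `t` (0-based). -/
def predAt (A : Adversary) (L : Learner) (t : ℕ) : Bool :=
  L ((hist A L t).map Prod.snd)

/-- The adversary's label at round `t` (0-based). -/
def labelAt (A : Adversary) (L : Learner) (t : ℕ) : Bool :=
  A (hist A L t) (predAt A L t)

/-- The number of mistakes the learner `L` makes in `n` rounds against adversary `A`. -/
def mistakes (A : Adversary) (L : Learner) (n : ℕ) : ℕ :=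
  ((Finset.range n).filter fun t => predAt A L t ≠ labelAt A L t).card

/-- The adversary `A` is realizable for the class `H` on the instance sequence `x`:
whatever the learner does, the produced labels are consistent with some `h ∈ H`. -/
def Realizable {X : Type*} (H : Set (X → Bool)) {n : ℕ} (x : Fin n → X) (A : Adversary) : Prop :=
  ∀ L : Learner, ∃ h ∈ H, ∀ i : Fin n, h (x i) = labelAt A L i

/-- The adversary `A` forces every learner to make at least `M` mistakes in `n` rounds. -/
def Forces (A : Adversary) (n M : ℕ) : Prop :=
  ∀ L : Learner, M ≤ mistakes A L n

/-- The minimal sequence length for forcing `M` mistakes for the class `H`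
(`⊤` if no sequence allows forcing `M` mistakes). -/
noncomputable def minSeq {X : Type*} (H : Set (X → Bool)) (M : ℕ) : ℕ∞ :=
  sInf {e : ℕ∞ | ∃ n : ℕ, e = (n : ℕ∞) ∧
    ∃ (x : Fin n → X) (A : Adversary), Realizable H x A ∧ Forces A n M}

/-- `f` witnesses the rigidity of the adversary `A` for sequences of length `n`:
on any history of length `< n` whose labels are `y`, the adversary answers `f y`
when `f y ∈ {0,1}` (`some` value), and answers the negation of the learner's current
prediction when `f y = ★` (`none`). -/
def RigidWitness (n : ℕ) (A : Adversary) (f : List Bool → Option Bool) : Prop :=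
  ∀ h : List (Bool × Bool), h.length < n → ∀ b : Bool,
    A h b = (f (h.map Prod.snd)).getD (!b)

/-- The adversary `A` is rigid (for sequences of length `n`). -/
def Rigid (n : ℕ) (A : Adversary) : Prop :=
  ∃ f : List Bool → Option Bool, RigidWitness n A f

/-- The (0-based) index `t` is essential for a rigid adversary with witness `f`,
for forcing `M` mistakes: there is a label sequence `y` of length `t` with `f y = ★`
such that `f (y.take 0), f (y.take 1), …, f (y.take t)` has at most `M - 1`
entries equal to `★` (`none`). -/
def Essential (f : List Bool → Option Bool) (M t : ℕ) : Prop :=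
  ∃ y : List Bool, y.length = t ∧ f y = none ∧
    ((Finset.range (t + 1)).filter fun i => f (y.take i) = none).card ≤ M - 1

/-- Recursive description of the adversary winning. -/
def Win {X : Type*} : List X → Set (X → Bool) → ℕ → Prop
  | [], V, M => V.Nonempty ∧ M = 0
  | x :: xs, V, M => ∀ b : Bool, ∃ y : Bool,
      Win xs {h ∈ V | h x = y} (M - if b ≠ y then 1 else 0)

theorem Win.nonempty {X : Type*} : ∀ (l : List X) (V : Set (X → Bool)) (M : ℕ),
    Win l V M → V.Nonempty
  | [], _, _, h => h.1
  | x :: xs, V, M, h => by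
      obtain ⟨y, hy⟩ := h true
      obtain ⟨g, hg⟩ := Win.nonempty xs _ _ hy
      exact ⟨g, hg.1⟩

theorem Win.mono {X : Type*} : ∀ (l : List X) (V W : Set (X → Bool)) (M : ℕ), V ⊆ W →
    Win l V M → Win l W M
  | [], _, _, _, hs, h => ⟨h.1.mono hs, h.2⟩
  | x :: xs, V, W, M, hs, h => fun b => by
      obtain ⟨y, hy⟩ := h b
      exact ⟨y, Win.mono xs _ _ _ (fun g hg => ⟨hs hg.1, hg.2⟩) hy⟩

theorem Win.zero {X : Type*} : ∀ (l : List X) (V : Set (X → Bool)), V.Nonempty → Win l V 0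
  | [], _, h => ⟨h, rfl⟩
  | x :: xs, V, ⟨g, hg⟩ => fun b => by
      refine ⟨g x, ?_⟩
      rw [Nat.zero_sub]
      exact Win.zero xs _ ⟨g, hg, rfl⟩

theorem Win.le {X : Type*} : ∀ (l : List X) (V : Set (X → Bool)) (M M' : ℕ), M' ≤ M →
    Win l V M → Win l V M'
  | [], _, _, _, hs, h => ⟨h.1, by have := h.2; omega⟩
  | x :: xs, V, M, M', hs, h => fun b => by
      obtain ⟨y, hy⟩ := h b
      exact ⟨y, Win.le xs _ _ _ (Nat.sub_le_sub_right hs _) hy⟩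

theorem win_restrict {ι X : Type*} [DecidableEq ι] (x : ι → X) (l : List ι) :
    ∀ (V : Set (X → Bool)) (M : ℕ), Win (l.map x) V M →
      ∃ I : Finset ι, I.card ≤ 2 ^ M - 1 ∧ ∀ J : Finset ι, I ⊆ J →
        Win ((l.filter (fun i => decide (i ∈ J))).map x) V M := by
  induction l with
  | nil =>
    intro V M h
    exact ⟨∅, by simp, fun J _ => h⟩
  | cons a l ih =>
    intro V M h
    have hne := Win.nonempty _ _ _ h
    rcases M with _ | k
    · exact ⟨∅, by simp, fun J _ => Win.zero _ _ hne⟩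
    have rule1 : ∀ y, Win (l.map x) {h ∈ V | h (x a) = y} (k + 1) →
        ∃ I : Finset ι, I.card ≤ 2 ^ (k + 1) - 1 ∧ ∀ J : Finset ι, I ⊆ J →
        Win (((a :: l).filter (fun i => decide (i ∈ J))).map x) V (k + 1) := by
      intro y hy
      obtain ⟨I, hI, hJ⟩ := ih _ _ hy
      refine ⟨I, hI, fun J hIJ => ?_⟩
      by_cases ha : a ∈ J
      · rw [List.filter_cons_of_pos (by simpa using ha), List.map_cons]
        -- the label `y` also works if more mistakes are demanded than needed
        intro b
        refine ⟨y, ?_⟩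
        by_cases hb : b = y
        · simpa [hb] using hJ J hIJ
        · exact Win.le _ _ _ _ (Nat.sub_le _ _) (hJ J hIJ)
      · rw [List.filter_cons_of_neg (by simpa using ha)]
        exact Win.mono _ _ _ _ (fun g hg => hg.1) (hJ J hIJ)
    obtain ⟨y1, h1⟩ := h true
    obtain ⟨y0, h0⟩ := h false
    rcases y1 with _ | _
    · rcases y0 with _ | _
      · exact rule1 false (by simpa using h0)
      · obtain ⟨I, hI, hJ⟩ := ih _ _ h1
        obtain ⟨I', hI', hJ'⟩ := ih _ _ h0
        refine ⟨insert a (I ∪ I'), ?_, fun J hIJ => ?_⟩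
        · have e1 := Finset.card_insert_le a (I ∪ I')
          have e2 := Finset.card_union_le I I'
          have e3 : 0 < 2 ^ k := by positivity
          simp at hI hI'
          rw [pow_succ]
          omega
        · have ha : a ∈ J := hIJ (by simp)
          rw [List.filter_cons_of_pos (by simpa using ha), List.map_cons]
          intro b
          rcases b with _ | _
          · exact ⟨true, hJ' J (fun i hi => hIJ (by simp [hi]))⟩
          · exact ⟨false, hJ J (fun i hi => hIJ (by simp [hi]))⟩
    · exact rule1 true (by simpa using h1)

/-- Adversary after a first round. -/
def shA (A : Adversary) (b : Bool) : Adversary := fun h p => A ((b, A [] b) :: h) p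

/-- Learner after a first round with label `y`. -/
def shL (L : Learner) (y : Bool) : Learner := fun ys => L (y :: ys)

theorem hist_shift (A : Adversary) (L : Learner) (t : ℕ) :
    hist A L (t + 1) = (L [], A [] (L [])) ::
      hist (shA A (L [])) (shL L (A [] (L []))) t := by
  induction t with
  | zero => simp [hist]
  | succ t ih =>
    rw [hist, ih]
    simp [hist, shA, shL]

theorem predAt_shift (A : Adversary) (L : Learner) (t : ℕ) :
    predAt A L (t + 1) = predAt (shA A (L [])) (shL L (A [] (L []))) t := by
  simp [predAt, hist_shift, shL]

theorem labelAt_shift (A : Adversary) (L : Learner) (t : ℕ) :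
    labelAt A L (t + 1) = labelAt (shA A (L [])) (shL L (A [] (L []))) t := by
  rw [labelAt, predAt_shift, hist_shift]
  rfl

theorem mistakes_shift (A : Adversary) (L : Learner) (n : ℕ) :
    mistakes A L (n + 1) = (if L [] ≠ A [] (L []) then 1 else 0) +
      mistakes (shA A (L [])) (shL L (A [] (L []))) n := by
  simp only [mistakes, Finset.card_filter]
  rw [Finset.sum_range_succ', add_comm]
  simp only [predAt_shift, labelAt_shift]
  rfl

/-- `A` is good for list `l`. -/
def Good {X : Type*} (l : List X) (V : Set (X → Bool)) (M : ℕ) (A : Adversary) : Prop :=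
  ∀ L : Learner, (∃ h ∈ V, ∀ i : Fin l.length, h (l.get i) = labelAt A L i) ∧
    M ≤ mistakes A L l.length

theorem good_cons {X : Type*} (x : X) (l : List X) (V : Set (X → Bool)) (M : ℕ)
    (A : Adversary) : Good (x :: l) V M A ↔ ∀ b,
      Good l {h ∈ V | h x = A [] b} (M - if b ≠ A [] b then 1 else 0) (shA A b) := by
  have key : ∀ L : Learner,
      ((∃ h ∈ V, ∀ i : Fin (x :: l).length, h ((x :: l).get i) = labelAt A L i) ∧
        M ≤ mistakes A L (x :: l).length) ↔
      ((∃ h ∈ {h ∈ V | h x = A [] (L [])}, ∀ i : Fin l.length,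
        h (l.get i) = labelAt (shA A (L [])) (shL L (A [] (L []))) i) ∧
        (M - if L [] ≠ A [] (L []) then 1 else 0) ≤
          mistakes (shA A (L [])) (shL L (A [] (L []))) l.length) := by
    intro L
    refine and_congr ?_ ?_
    · refine exists_congr fun h => ?_
      have : (∀ i : Fin (x :: l).length, h ((x :: l).get i) = labelAt A L i) ↔
          h x = A [] (L []) ∧ ∀ i : Fin l.length,
            h (l.get i) = labelAt (shA A (L [])) (shL L (A [] (L []))) i := by
        refine (Fin.forall_fin_succ (n := l.length)).trans (and_congr ?_ ?_)
        · rfl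
        · refine forall_congr' fun i => ?_
          rw [← labelAt_shift]
          rfl
      rw [this, Set.mem_setOf_eq, and_assoc]
    · rw [List.length_cons, mistakes_shift, Nat.sub_le_iff_le_add']
  constructor
  · intro h b L'
    have := (key (fun ys => match ys with | [] => b | _ :: t => L' t)).1 (h _)
    exact this
  · intro h L
    exact (key L).2 (h (L []) _)

theorem win_of_good {X : Type*} (l : List X) : ∀ (V : Set (X → Bool)) (M : ℕ) (A : Adversary),
    Good l V M A → Win l V M := by
  induction l with
  | nil =>
    intro V M A h
    obtain ⟨⟨g, hg, _⟩, h2⟩ := h (fun _ => true)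
    exact ⟨⟨g, hg⟩, by simpa [mistakes] using h2⟩
  | cons x l ih =>
    intro V M A h b
    exact ⟨A [] b, ih _ _ _ ((good_cons x l V M A).1 h b)⟩

theorem good_of_win {X : Type*} (l : List X) : ∀ (V : Set (X → Bool)) (M : ℕ),
    Win l V M → ∃ A, Good l V M A := by
  induction l with
  | nil =>
    rintro V M ⟨⟨g, hg⟩, rfl⟩
    exact ⟨fun _ _ => true, fun L => ⟨⟨g, hg, fun i => i.elim0⟩, Nat.zero_le _⟩⟩
  | cons x l ih =>
    intro V M h
    choose y hy using h
    choose B hB using fun b => ih _ _ (hy b)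
    refine ⟨fun h p => match h with | [] => y p | (b, _) :: t => B b t p, ?_⟩
    rw [good_cons]
    intro b
    exact hB b

/-- If the minimal sequence length for forcing `M` mistakes for the class `H` is
finite, then it is at most `2 ^ M - 1`. -/
theorem minSeq_le_two_pow_sub_one {X : Type*} (M : ℕ) (H : Set (X → Bool))
    (hfin : minSeq H M < ⊤) :
    minSeq H M ≤ ((2 ^ M - 1 : ℕ) : ℕ∞) := by
  obtain ⟨_, ⟨n, rfl, x, A, hR, hF⟩, _⟩ := sInf_lt_iff.1 hfin
  have hg : Good ((List.finRange n).map x) H M A := by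
    intro L
    refine ⟨?_, by simpa using hF L⟩
    obtain ⟨h, hh, he⟩ := hR L
    refine ⟨h, hh, fun i => ?_⟩
    have := he ⟨i, by simpa using i.2⟩
    simpa using this
  obtain ⟨I, hI, hJ⟩ := win_restrict x _ _ _ (win_of_good _ _ _ _ hg)
  obtain ⟨A', hA'⟩ := good_of_win _ _ _ (hJ I (Finset.Subset.refl I))
  refine le_trans (sInf_le ⟨_, rfl, List.get _, A', fun L => (hA' L).1, fun L => (hA' L).2⟩) ?_
  refine Nat.cast_le.2 (le_trans ?_ hI)
  rw [List.length_map, ← List.toFinset_card_of_nodup ((List.nodup_finRange n).filter _)]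
  refine Finset.card_le_card fun i hi => ?_
  simpa using hi
end

section
/- For every M ∈ ℕ there exist a set X and a hypothesis class H ⊆ {0,1}^X such that the minimal sequence length for forcing M mistakes satisfies N(H,M) = 2^M − 1. -/
inductive Win_s1 : Set (ℕ → Bool) → List ℕ → ℕ → Prop
  | nil {V : Set (ℕ → Bool)} (h : ℕ → Bool) (hV : h ∈ V) : Win_s1 V [] 0
  | pass {V : Set (ℕ → Bool)} {x : ℕ} {xs : List ℕ} {m : ℕ} (b : Bool)
      (w : Win_s1 {h | h ∈ V ∧ h x = b} xs m) : Win_s1 V (x :: xs) m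
  | split {V : Set (ℕ → Bool)} {x : ℕ} {xs : List ℕ} {m : ℕ}
      (w : ∀ b : Bool, Win_s1 {h | h ∈ V ∧ h x = b} xs m) : Win_s1 V (x :: xs) (m + 1)

lemma Win_s1.mono {V : Set (ℕ → Bool)} {xs : List ℕ} {m : ℕ} (w : Win_s1 V xs m) :
    ∀ {V' : Set (ℕ → Bool)}, V ⊆ V' → Win_s1 V' xs m := by
  induction w with
  | nil h hV => intro V' hs; exact .nil h (hs hV)
  | pass b w ih => intro V' hs; exact .pass b (ih fun h hh => ⟨hs hh.1, hh.2⟩)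
  | split w ih => intro V' hs; exact .split fun b => ih b fun h hh => ⟨hs hh.1, hh.2⟩

lemma Win_s1.of_mem {V : Set (ℕ → Bool)} (h : ℕ → Bool) (hV : h ∈ V) (ys : List ℕ) : Win_s1 V ys 0 := by
  induction ys generalizing V with
  | nil => exact .nil h hV
  | cons y ys ih => exact .pass (h y) (ih ⟨hV, rfl⟩)

lemma Win_s1.append {V : Set (ℕ → Bool)} {xs : List ℕ} {m : ℕ} (w : Win_s1 V xs m) (ys : List ℕ) :
    Win_s1 V (xs ++ ys) m := by
  induction w with
  | nil h hV => exact .of_mem h hV ys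
  | pass b w ih => exact .pass b ih
  | split w ih => exact .split ih

lemma Win_s1.prepend {V : Set (ℕ → Bool)} {ys : List ℕ} {m : ℕ} (w : Win_s1 V ys m) (xs : List ℕ)
    (hc : ∀ x ∈ xs, ∃ b, ∀ h ∈ V, h x = b) : Win_s1 V (xs ++ ys) m := by
  induction xs with
  | nil => exact w
  | cons x xs ih =>
    obtain ⟨b, hb⟩ := hc x (by simp)
    exact .pass b ((ih fun z hz => hc z (by simp [hz])).mono fun h hh => ⟨hh, hb h hh⟩)

def Adversary.tail (A : Adversary) (q : Bool × Bool) : Adversary := fun h => A (q :: h)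
def Learner.tail (L : Learner) (y : Bool) : Learner := fun ys => L (y :: ys)

lemma hist_cons (A : Adversary) (L : Learner) (t : ℕ) :
    hist A L (t + 1) = (L [], A [] (L [])) ::
      hist (A.tail (L [], A [] (L []))) (L.tail (A [] (L []))) t := by
  induction t with
  | zero => simp [hist]
  | succ t ih =>
    rw [hist, ih]
    simp [hist, Adversary.tail, Learner.tail]

lemma predAt_cons (A : Adversary) (L : Learner) (t : ℕ) :
    predAt A L (t + 1) =
      predAt (A.tail (L [], A [] (L []))) (L.tail (A [] (L []))) t := by
  simp [predAt, hist_cons, Learner.tail]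

lemma labelAt_cons (A : Adversary) (L : Learner) (t : ℕ) :
    labelAt A L (t + 1) =
      labelAt (A.tail (L [], A [] (L []))) (L.tail (A [] (L []))) t := by
  rw [labelAt, labelAt, predAt_cons, hist_cons, Adversary.tail]

lemma mistakes_cons (A : Adversary) (L : Learner) (n : ℕ) :
    mistakes A L (n + 1) =
      mistakes (A.tail (L [], A [] (L []))) (L.tail (A [] (L []))) n
        + if L [] ≠ A [] (L []) then 1 else 0 := by
  unfold mistakes
  rw [Finset.card_filter, Finset.sum_range_succ', Finset.card_filter]
  simp only [predAt_cons, labelAt_cons]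
  rfl

lemma Win_s1.exists_adversary {V : Set (ℕ → Bool)} {xs : List ℕ} {m : ℕ} (w : Win_s1 V xs m) :
    ∃ A : Adversary, ∀ L : Learner,
      (∃ h ∈ V, ∀ (i : ℕ) (hi : i < xs.length), h xs[i] = labelAt A L i) ∧
      m ≤ mistakes A L xs.length := by
  induction w with
  | nil h hV => exact ⟨fun _ _ => false, fun L => ⟨⟨h, hV, by simp⟩, by simp⟩⟩
  | @pass V x xs m b w ih =>
    obtain ⟨A, hA⟩ := ih
    refine ⟨fun h p => match h with
      | [] => b
      | _ :: h => A h p, fun L => ?_⟩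
    obtain ⟨⟨h, hV, hh⟩, hm⟩ := hA (L.tail b)
    refine ⟨⟨h, hV.1, ?_⟩, ?_⟩
    · intro i hi
      cases i with
      | zero => exact hV.2
      | succ i =>
        rw [labelAt_cons]
        exact hh i (by simpa using hi)
    · rw [List.length_cons, mistakes_cons]
      exact le_trans hm (Nat.le_add_right _ _)
  | @split V x xs m w ih =>
    choose A hA using ih
    refine ⟨fun h p => match h with
      | [] => !p
      | q :: h => A q.2 h p, fun L => ?_⟩
    obtain ⟨⟨h, hV, hh⟩, hm⟩ := hA (!(L [])) (L.tail (!(L [])))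
    refine ⟨⟨h, hV.1, ?_⟩, ?_⟩
    · intro i hi
      cases i with
      | zero => exact hV.2
      | succ i =>
        rw [labelAt_cons]
        exact hh i (by simpa using hi)
    · rw [List.length_cons, mistakes_cons]
      have : (L [] ≠ !(L [])) := by cases L [] <;> simp
      rw [if_pos this]
      exact Nat.add_le_add_right hm 1

/-- threshold function -/
def thr (k : ℕ) : ℕ → Bool := fun x => decide (x < k)

/-- preorder list of queries -/
def qs : ℕ → ℕ → List ℕ
  | _, 0 => []
  | a, m + 1 => (a + 2 ^ m - 1) :: (qs a m ++ qs (a + 2 ^ m) m)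

lemma qs_length (a m : ℕ) : (qs a m).length = 2 ^ m - 1 := by
  induction m generalizing a with
  | zero => rfl
  | succ m ih =>
    have := Nat.one_le_two_pow (n := m)
    simp only [qs, List.length_cons, List.length_append, ih]
    rw [pow_succ]; omega

lemma qs_lt (a m x : ℕ) (hx : x ∈ qs a m) : x + 1 < a + 2 ^ m := by
  induction m generalizing a with
  | zero => simp [qs] at hx
  | succ m ih =>
    have := Nat.one_le_two_pow (n := m)
    simp only [qs, List.mem_cons, List.mem_append] at hx
    rw [pow_succ]
    rcases hx with h | h | h
    · omega
    · have := ih _ h; omega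
    · have := ih _ h; omega

lemma win_qs (m a : ℕ) : Win_s1 {h | ∃ k, a ≤ k ∧ k < a + 2 ^ m ∧ h = thr k} (qs a m) m := by
  induction m generalizing a with
  | zero => exact .nil (thr a) ⟨a, by simp⟩
  | succ m ih =>
    have h1 := Nat.one_le_two_pow (n := m)
    refine .split fun b => ?_
    cases b with
    | false =>
      refine ((ih a).append _).mono ?_
      rintro h ⟨k, hk, hk', rfl⟩
      refine ⟨⟨k, hk, by rw [pow_succ]; omega, rfl⟩, ?_⟩
      simp only [thr, decide_eq_false_iff_not]; omega
    | true =>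
      refine ((ih (a + 2 ^ m)).prepend (qs a m) ?_).mono ?_
      · intro x hx
        refine ⟨true, ?_⟩
        rintro h ⟨k, hk, hk', rfl⟩
        have := qs_lt _ _ _ hx
        simp only [thr, decide_eq_true_eq]; omega
      · rintro h ⟨k, hk, hk', rfl⟩
        refine ⟨⟨k, by omega, by rw [pow_succ]; omega, rfl⟩, ?_⟩
        simp only [thr, decide_eq_true_eq]; omega

lemma hist_labels (A : Adversary) (L : Learner) (t : ℕ) :
    (hist A L t).map Prod.snd = (List.range t).map (labelAt A L) := by
  induction t with
  | zero => rfl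
  | succ t ih =>
    rw [List.range_succ, List.map_append, ← ih, hist]
    simp [labelAt, predAt]

/-- version space after the labels `ys` -/
def vs (K : Finset ℕ) (x : ℕ → ℕ) (ys : List Bool) : Finset ℕ :=
  K.filter fun k => ∀ i < ys.length, thr k (x i) = ys.getD i false

/-- halving learner -/
def halving (K : Finset ℕ) (x : ℕ → ℕ) : Learner := fun ys =>
  decide (((vs K x ys).filter fun k => thr k (x ys.length) = false).card ≤
    ((vs K x ys).filter fun k => thr k (x ys.length) = true).card)

lemma vs_append (K : Finset ℕ) (x : ℕ → ℕ) (ys : List Bool) (y : Bool) :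
    vs K x (ys ++ [y]) = (vs K x ys).filter fun k => thr k (x ys.length) = y := by
  ext k
  simp only [vs, Finset.mem_filter, List.length_append, List.length_singleton]
  constructor
  · rintro ⟨hk, h⟩
    refine ⟨⟨hk, fun i hi => ?_⟩, ?_⟩
    · rw [h i (by omega), List.getD_append _ _ _ _ hi]
    · rw [h _ (by omega)]; simp
  · rintro ⟨⟨hk, h⟩, hy⟩
    refine ⟨hk, fun i hi => ?_⟩
    rcases Nat.lt_or_ge i ys.length with h' | h'
    · rw [h i h', List.getD_append _ _ _ _ h']
    · obtain rfl : i = ys.length := by omega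
      rw [hy]; simp

lemma vs_step (K : Finset ℕ) (x : ℕ → ℕ) (ys : List Bool) (y : Bool) (hy : halving K x ys ≠ y) :
    2 * (vs K x (ys ++ [y])).card ≤ (vs K x ys).card := by
  rw [vs_append]
  have h := Finset.card_filter_add_card_filter_not (s := vs K x ys)
    (fun k => thr k (x ys.length) = true)
  simp only [Bool.not_eq_true] at h
  unfold halving at hy
  cases y
  · simp only [ne_eq, decide_eq_false_iff_not, not_not] at hy
    omega
  · simp only [ne_eq, decide_eq_true_eq, not_le] at hy
    omega

lemma halving_bound (K : Finset ℕ) (x : ℕ → ℕ) (A : Adversary) (t : ℕ) :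
    2 ^ mistakes A (halving K x) t *
      (vs K x ((hist A (halving K x) t).map Prod.snd)).card ≤ K.card := by
  induction t with
  | zero => simp [mistakes, hist, vs]
  | succ t ih =>
    set L := halving K x with hL
    have hs : (hist A L (t + 1)).map Prod.snd
        = (hist A L t).map Prod.snd ++ [labelAt A L t] := by
      simp [hist, labelAt, predAt]
    rw [hs]
    have hm : mistakes A L (t + 1) =
        mistakes A L t + if predAt A L t ≠ labelAt A L t then 1 else 0 := by
      unfold mistakes
      rw [Finset.card_filter, Finset.sum_range_succ, Finset.card_filter]
    rw [hm]
    split_ifs with hne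
    · have := vs_step K x ((hist A L t).map Prod.snd) (labelAt A L t) hne
      refine le_trans ?_ ih
      rw [pow_succ, mul_assoc]
      exact Nat.mul_le_mul_left _ this
    · refine le_trans ?_ ih
      rw [add_zero]
      refine Nat.mul_le_mul_left _ (Finset.card_le_card ?_)
      rw [vs_append]
      exact Finset.filter_subset _ _

lemma lower_bound (M n : ℕ) (x : Fin n → ℕ) (A : Adversary)
    (hR : Realizable {h | ∃ k, 0 ≤ k ∧ k < 0 + 2 ^ M ∧ h = thr k} x A) (hF : Forces A n M) :
    2 ^ M - 1 ≤ n := by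
  by_contra hn
  push Not at hn
  obtain ⟨v, hv, hvx⟩ : ∃ v ∈ Finset.range (2 ^ M - 1), v ∉ Finset.univ.image x := by
    apply Finset.exists_mem_notMem_of_card_lt_card
    refine lt_of_le_of_lt Finset.card_image_le ?_
    simpa using hn
  have hvx' : ∀ i, x i ≠ v := fun i hi => hvx (by simp [← hi])
  rw [Finset.mem_range] at hv
  let x' : ℕ → ℕ := fun i => if h : i < n then x ⟨i, h⟩ else 0
  let K := (Finset.range (2 ^ M)).erase v
  have hK : K.card = 2 ^ M - 1 := by
    rw [Finset.card_erase_of_mem (by rw [Finset.mem_range]; omega), Finset.card_range]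
  have hb := halving_bound K x' A n
  have hf := hF (halving K x')
  obtain ⟨h, ⟨k, -, hk, rfl⟩, hh⟩ := hR (halving K x')
  have hne : (vs K x' ((hist A (halving K x') n).map Prod.snd)).Nonempty := by
    refine ⟨if k = v then v + 1 else k, ?_⟩
    simp only [vs, Finset.mem_filter, K, Finset.mem_erase, Finset.mem_range, hist_labels]
    refine ⟨⟨by split_ifs <;> omega, by split_ifs <;> omega⟩, ?_⟩
    intro i hi
    have hi' : i < n := by simpa using hi
    have e : ((List.range n).map (labelAt A (halving K x'))).getD i false
        = labelAt A (halving K x') i := by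
      rw [List.getD_eq_getElem _ _ hi]; simp; rfl
    rw [e, ← hh ⟨i, hi'⟩]
    have hx := hvx' ⟨i, hi'⟩
    simp only [x', dif_pos hi', thr, decide_eq_decide]
    split_ifs <;> omega
  have h1 := hne.card_pos
  have h2 : 2 ^ M ≤ 2 ^ mistakes A (halving K x') n := Nat.pow_le_pow_right (by norm_num) hf
  have h3 := Nat.le_mul_of_pos_right (2 ^ mistakes A (halving K x') n) h1
  have h4 := Nat.one_le_two_pow (n := M)
  omega

/-- For every `M` there is a class `H` whose minimal sequence length for forcing
`M` mistakes is exactly `2 ^ M - 1`. -/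
theorem exists_class_minSeq_eq_two_pow_sub_one (M : ℕ) :
    ∃ (X : Type) (H : Set (X → Bool)), minSeq H M = ((2 ^ M - 1 : ℕ) : ℕ∞) := by
  refine ⟨ℕ, {h | ∃ k, 0 ≤ k ∧ k < 0 + 2 ^ M ∧ h = thr k}, le_antisymm ?_ ?_⟩
  · obtain ⟨A, hA⟩ := (win_qs M 0).exists_adversary
    apply sInf_le
    refine ⟨(qs 0 M).length, by rw [qs_length], fun i => (qs 0 M)[i], A, fun L => ?_, fun L => (hA L).2⟩
    obtain ⟨h, hV, hh⟩ := (hA L).1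
    exact ⟨h, hV, fun i => hh i i.2⟩
  · apply le_sInf
    rintro e ⟨n, rfl, x, A, hR, hF⟩
    exact_mod_cast lower_bound M n x A hR hF
end

section
/- Let n, M ∈ ℕ, let X be a set, let x ∈ X^n, and let H ⊆ {0,1}^X. If there exists a realizable adversary strategy A for x that forces every learner to make at least M mistakes on x, then there exists a realizable adversary strategy A* for x that is rigid and also forces every learner to make at least M mistakes on x. -/
/-- `A` contradicts the learner at history `h` whatever the prediction. -/
def starAt (A : Adversary) (h : List (Bool × Bool)) : Bool := !(A h true) && A h false

/-- One step of the reconstructed history. -/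
def stepH (A : Adversary) (h : List (Bool × Bool)) (c : Bool) : List (Bool × Bool) :=
  h ++ [(if starAt A h then !c else c, c)]

/-- The history reconstructed from the labels. -/
def recH (A : Adversary) (y : List Bool) : List (Bool × Bool) := y.foldl (stepH A) []

theorem recH_snoc (A : Adversary) (y : List Bool) (c : Bool) :
    recH A (y ++ [c]) = stepH A (recH A y) c := by
  simp [recH]

theorem recH_labels (A : Adversary) (y : List Bool) : (recH A y).map Prod.snd = y := by
  induction y using List.reverseRecOn with
  | nil => rfl
  | append_singleton y c ih => rw [recH_snoc]; simp [stepH, ih]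

/-- The rigid witness. -/
def rigF (A : Adversary) (y : List Bool) : Option Bool :=
  if starAt A (recH A y) then none else some (A (recH A y) true)

/-- The rigid adversary. -/
def rigA (A : Adversary) : Adversary := fun h b => (rigF A (h.map Prod.snd)).getD (!b)

/-- The simulated learner. -/
def simL (A : Adversary) (L : Learner) : Learner := fun y =>
  if starAt A (recH A y) then L y else A (recH A y) true

theorem sim_hist (A : Adversary) (L : Learner) (t : ℕ) :
    hist A (simL A L) t = recH A ((hist (rigA A) L t).map Prod.snd) := by
  induction t with
  | zero => rfl
  | succ t ih =>
    simp only [hist, List.map_append, List.map_cons, List.map_nil]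
    rw [recH_snoc, ih, recH_labels]
    simp only [stepH, rigA, rigF, simL]
    generalize hist (rigA A) L t = h0 at *
    generalize h0.map Prod.snd = y
    generalize recH A y = h
    have e : starAt A h = (!(A h true) && A h false) := rfl
    rw [e]
    generalize L y = p
    cases h1 : A h true <;> cases h2 : A h false <;> cases p <;> simp [h1, h2]

theorem sim_round (A : Adversary) (L : Learner) (t : ℕ) :
    labelAt A (simL A L) t = labelAt (rigA A) L t ∧
    (predAt A (simL A L) t ≠ labelAt A (simL A L) t →
      predAt (rigA A) L t ≠ labelAt (rigA A) L t) := by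
  simp only [labelAt, predAt, sim_hist, recH_labels]
  generalize hist (rigA A) L t = h0
  simp only [rigA, rigF, simL]
  generalize h0.map Prod.snd = y
  generalize recH A y = h
  have e : starAt A h = (!(A h true) && A h false) := rfl
  rw [e]
  generalize L y = p
  cases h1 : A h true <;> cases h2 : A h false <;> cases p <;> simp [h1, h2]

/-- If some realizable adversary forces `M` mistakes on `x`, then some realizable
*rigid* adversary forces `M` mistakes on `x`. -/
theorem exists_rigid_adversary {X : Type*} (n M : ℕ) (x : Fin n → X)
    (H : Set (X → Bool)) (A : Adversary)
    (hreal : Realizable H x A) (hforce : Forces A n M) :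
    ∃ A' : Adversary, Realizable H x A' ∧ Rigid n A' ∧ Forces A' n M := by
  refine ⟨rigA A, fun L => ?_, ⟨rigF A, fun h _ b => rfl⟩, fun L => ?_⟩
  · obtain ⟨h, hh, hx⟩ := hreal (simL A L)
    exact ⟨h, hh, fun i => (hx i).trans (sim_round A L i).1⟩
  · refine (hforce (simL A L)).trans (Finset.card_le_card ?_)
    intro t ht
    rw [Finset.mem_filter] at ht ⊢
    exact ⟨ht.1, (sim_round A L t).2 ht.2⟩
end
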